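/- Let m ≥ 2, a ≥ 1, and λ = (am) the one-row partition of size am. For each divisor d of m, the quantity a_d := (1/d) ∑_{e ∣ d} μ(d/e) ∏_{1 ≤ k < e} (ae/k + 1) is a nonnegative integer, and the principal specialization s_λ(1,q,...,q^{m-1}) of the Schur polynomial of the one-row shape (am), which equals the Gaussian binomial coefficient [am + m - 1 choose m - 1]_q, satisfies [am + m - 1 choose m - 1]_q ≡ ∑_{d ∣ m} a_d · (q^m - 1)/(q^{m/d} - 1) (mod q^m - 1). -/

import Mathlib

open Finset Polynomial

/-- The Gaussian binomial coefficient, as a polynomial with natural number coefficients. -/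
noncomputable def gaussianBinomial : ℕ → ℕ → ℕ[X]
  | _, 0 => 1
  | 0, _ + 1 => 0
  | n + 1, k + 1 => gaussianBinomial n k + X ^ (k + 1) * gaussianBinomial n (k + 1)

theorem gaussianBinomial_mul_prod (R : Type*) [CommRing R] (n k : ℕ) :
    (gaussianBinomial n k).map (Nat.castRingHom R) * ∏ i ∈ range k, (1 - (X : R[X]) ^ (i + 1)) =
      ∏ i ∈ range k, (1 - (X : R[X]) ^ (n - i)) := by
  induction n generalizing k with
  | zero =>
    cases k with
    | zero => simp [gaussianBinomial]
    | succ k => simp [gaussianBinomial, prod_const]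
  | succ n ih =>
    cases k with
    | zero => simp [gaussianBinomial]
    | succ k =>
      have h₁ := ih k
      have h₂ := ih (k + 1)
      rw [prod_range_succ, prod_range_succ] at h₂
      rw [prod_range_succ, prod_range_succ' (fun i => 1 - (X : R[X]) ^ (n + 1 - i))]
      simp only [Nat.add_sub_add_right, Nat.sub_zero, gaussianBinomial, Polynomial.map_add,
        Polynomial.map_mul, Polynomial.map_pow, map_X]
      rcases le_or_gt k n with hkn | hkn
      · have hX : (X : R[X]) ^ (n + 1) = X ^ (k + 1) * X ^ (n - k) := by
          rw [← pow_add]; congr 1; omega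
        rw [hX]
        linear_combination (1 - X ^ (k + 1)) * h₁ + X ^ (k + 1) * h₂
      · have h₀ : ∏ i ∈ range k, (1 - (X : R[X]) ^ (n - i)) = 0 :=
          prod_eq_zero (mem_range.2 hkn) (by simp)
        rw [h₀] at h₁ h₂ ⊢
        linear_combination (1 - X ^ (k + 1)) * h₁ + X ^ (k + 1) * h₂

theorem prod_one_sub_X_pow_reflect (R : Type*) [CommRing R] (m b : ℕ) :
    ∏ i ∈ range (m - 1), (1 - (X : R[X]) ^ (b + m - 1 - i)) =
      ∏ k ∈ Ico 1 m, (1 - (X : R[X]) ^ (b + k)) := by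
  rw [prod_Ico_eq_prod_range, ← prod_range_reflect]
  refine prod_congr rfl fun i hi => ?_
  have := mem_range.1 hi
  congr 2
  omega

/-- The factor of `1 - X ^ k` that does not vanish at primitive `r`-th roots of unity. -/
noncomputable def oneSubPowCofactor (R : Type*) [CommRing R] (r k : ℕ) : R[X] :=
  if r ∣ k then ∑ j ∈ range (k / r), (X ^ r) ^ j else 1 - X ^ k

theorem one_sub_X_pow_eq_mul_cofactor (R : Type*) [CommRing R] (r k : ℕ) :
    1 - (X : R[X]) ^ k = (if r ∣ k then 1 - X ^ r else 1) * oneSubPowCofactor R r k := by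
  unfold oneSubPowCofactor
  split_ifs with h
  · rw [mul_neg_geom_sum, ← pow_mul, Nat.mul_div_cancel' h]
  · rw [one_mul]

theorem eval_oneSubPowCofactor_of_dvd {R : Type*} [CommRing R] {r k : ℕ} {ω : R}
    (hω : ω ^ r = 1) (h : r ∣ k) : (oneSubPowCofactor R r k).eval ω = ((k / r : ℕ) : R) := by
  simp [oneSubPowCofactor, h, eval_finsetSum, hω]

theorem eval_oneSubPowCofactor_of_not_dvd {R : Type*} [CommRing R] {r k : ℕ} {ω : R}
    (h : ¬ r ∣ k) : (oneSubPowCofactor R r k).eval ω = 1 - ω ^ k := by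
  simp [oneSubPowCofactor, h]

theorem prod_Ico_ite_dvd {M : Type*} [CommMonoid M] {r : ℕ} (hr : 0 < r) (n : ℕ) (f : ℕ → M) :
    ∏ k ∈ Ico 1 (r * n), (if r ∣ k then f (k / r) else 1) = ∏ l ∈ Ico 1 n, f l := by
  rw [← prod_filter]
  refine prod_nbij' (fun k => k / r) (fun l => r * l) ?_ ?_ ?_ ?_ ?_
  · intro k hk
    simp only [mem_filter, mem_Ico] at hk ⊢
    obtain ⟨⟨h1, h2⟩, l, rfl⟩ := hk
    rw [Nat.mul_div_cancel_left _ hr]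
    exact ⟨Nat.pos_of_ne_zero (by rintro rfl; simp at h1), lt_of_mul_lt_mul_left h2 hr.le⟩
  · intro l hl
    simp only [mem_filter, mem_Ico] at hl ⊢
    exact ⟨⟨Nat.mul_pos hr hl.1, Nat.mul_lt_mul_of_pos_left hl.2 hr⟩, dvd_mul_right _ _⟩
  · intro k hk
    exact Nat.mul_div_cancel' (mem_filter.1 hk).2
  · intro l _
    exact Nat.mul_div_cancel_left _ hr
  · intro k _
    rfl

theorem eval_gaussian_of_isPrimitiveRoot {K : Type*} [Field K] [CharZero K] {r n a : ℕ}
    (hr : 0 < r) {ω : K} (hω : IsPrimitiveRoot ω r) {g : K[X]}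
    (hg : g * ∏ k ∈ Ico 1 (r * n), (1 - X ^ k) =
      ∏ k ∈ Ico 1 (r * n), (1 - X ^ (a * (r * n) + k))) :
    g.eval ω = ∏ l ∈ Ico 1 n, (((a * n : ℕ) : K) / l + 1) := by
  have hdvd (k : ℕ) : r ∣ a * (r * n) + k ↔ r ∣ k :=
    Nat.dvd_add_right ⟨a * n, by ring⟩
  rw [prod_congr rfl fun k _ => one_sub_X_pow_eq_mul_cofactor K r k,
    prod_congr rfl fun k _ => one_sub_X_pow_eq_mul_cofactor K r (a * (r * n) + k),
    prod_mul_distrib, prod_mul_distrib] at hg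
  simp_rw [hdvd] at hg
  have hc : ∏ k ∈ Ico 1 (r * n), (if r ∣ k then 1 - (X : K[X]) ^ r else 1) ≠ 0 := by
    refine prod_ne_zero_iff.2 fun k _ => ?_
    split_ifs
    · exact sub_ne_zero.2 fun h => by simpa [hr.ne] using congrArg natDegree h
    · exact one_ne_zero
  have hg' : g * ∏ k ∈ Ico 1 (r * n), oneSubPowCofactor K r k =
      ∏ k ∈ Ico 1 (r * n), oneSubPowCofactor K r (a * (r * n) + k) :=
    mul_left_cancel₀ hc (by linear_combination hg)
  have hne (k : ℕ) (hk : k ∈ Ico 1 (r * n)) : (oneSubPowCofactor K r k).eval ω ≠ 0 := by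
    by_cases h : r ∣ k
    · rw [eval_oneSubPowCofactor_of_dvd hω.pow_eq_one h]
      exact_mod_cast (Nat.div_pos (Nat.le_of_dvd (mem_Ico.1 hk).1 h) hr).ne'
    · rw [eval_oneSubPowCofactor_of_not_dvd h, sub_ne_zero]
      exact fun h' => h (hω.dvd_of_pow_eq_one _ h'.symm)
  have he := congrArg (eval ω) hg'
  rw [eval_mul, eval_prod, eval_prod] at he
  refine mul_right_cancel₀ (prod_ne_zero_iff.2 hne) ?_
  rw [he, ← prod_Ico_ite_dvd hr n (fun l => ((a * n : ℕ) : K) / l + 1), ← prod_mul_distrib]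
  refine prod_congr rfl fun k hk => ?_
  have hk0 := hne k hk
  by_cases h : r ∣ k
  · rw [eval_oneSubPowCofactor_of_dvd hω.pow_eq_one h] at hk0 ⊢
    rw [eval_oneSubPowCofactor_of_dvd hω.pow_eq_one ((hdvd k).2 h), if_pos h,
      show a * (r * n) + k = r * (a * n) + k by ring, Nat.mul_add_div hr]
    push_cast
    field_simp
  · rw [eval_oneSubPowCofactor_of_not_dvd h, if_neg h, one_mul,
      eval_oneSubPowCofactor_of_not_dvd (mt (hdvd k).1 h), pow_add,
      show a * (r * n) = r * (a * n) by ring, pow_mul, hω.pow_eq_one, one_pow, one_mul]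

theorem geom_sum_pow_eq_ite {K : Type*} [Field K] {r n d : ℕ} (hr : 0 < r) (hn : 0 < n) {ω : K}
    (hω : IsPrimitiveRoot ω r) (hd : d ∣ r * n) :
    ∑ j ∈ range d, ω ^ (j * (r * n / d)) = if d ∣ n then (d : K) else 0 := by
  obtain ⟨c, hc⟩ := hd
  have hd0 : 0 < d := Nat.pos_of_mul_pos_right (hc ▸ Nat.mul_pos hr hn)
  rw [hc, Nat.mul_div_cancel_left _ hd0]
  have hpow : (ω ^ c) ^ d = 1 := by
    rw [← pow_mul, mul_comm, ← hc, pow_mul, hω.pow_eq_one, one_pow]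
  have hiff : ω ^ c = 1 ↔ d ∣ n := by
    rw [hω.pow_eq_one_iff_dvd]
    constructor
    · rintro ⟨t, rfl⟩
      exact ⟨t, Nat.eq_of_mul_eq_mul_left hr (by linear_combination hc)⟩
    · rintro ⟨t, rfl⟩
      exact ⟨t, Nat.eq_of_mul_eq_mul_left hd0 (by linear_combination -hc)⟩
  simp_rw [mul_comm _ c, pow_mul]
  split_ifs with h
  · simp [hiff.2 h]
  · have := mul_neg_geom_sum (ω ^ c) d
    rw [hpow, sub_self] at this
    exact (mul_eq_zero.1 this).resolve_left (sub_ne_zero.2 fun h' => h (hiff.1 h'.symm))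

theorem X_pow_sub_one_dvd_of_eval_eq_zero {m : ℕ} (hm : 0 < m) {f : ℚ[X]}
    (hf : ∀ ω : ℂ, ω ^ m = 1 → (f.map (algebraMap ℚ ℂ)).eval ω = 0) : X ^ m - 1 ∣ f := by
  rw [← map_dvd_map' (algebraMap ℚ ℂ)]
  rw [Polynomial.map_sub, Polynomial.map_pow, map_X, Polynomial.map_one,
    X_pow_sub_one_eq_prod hm (Complex.isPrimitiveRoot_exp m hm.ne')]
  refine Finset.prod_dvd_of_coprime
    (fun x _ y _ hxy => pairwise_coprime_X_sub_C Function.injective_id hxy) fun ω hω => ?_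
  exact dvd_iff_isRoot.2 (hf ω ((mem_nthRootsFinset hm 1).1 hω))

theorem sum_divisors_mul_eq_of_moebius {A P : ℕ → ℚ}
    (hA : ∀ d, A d = (∑ e ∈ d.divisors, (ArithmeticFunction.moebius (d / e) : ℚ) * P e) / d)
    {n : ℕ} (hn : 0 < n) : ∑ d ∈ n.divisors, (d : ℚ) * A d = P n := by
  refine (ArithmeticFunction.sum_eq_iff_sum_mul_moebius_eq (f := fun d => (d : ℚ) * A d)
    (g := P)).2 (fun d hd => ?_) n hn
  have : (d : ℚ) ≠ 0 := by exact_mod_cast hd.ne'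
  rw [hA, mul_div_cancel₀ _ this, Nat.sum_divisorsAntidiagonal'
    (fun x y => (ArithmeticFunction.moebius x : ℚ) * P y)]

theorem X_pow_sub_one_dvd_gaussian_sub {m a : ℕ} (hm : 0 < m) {A : ℕ → ℚ}
    (hA : ∀ d, A d = (∑ e ∈ d.divisors, (ArithmeticFunction.moebius (d / e) : ℚ) *
        ∏ k ∈ Ico 1 e, (((a * e : ℕ) : ℚ) / k + 1)) / d)
    {g : ℚ[X]}
    (hg : g * ∏ i ∈ range (m - 1), (1 - (X : ℚ[X]) ^ (i + 1)) =
        ∏ i ∈ range (m - 1), (1 - (X : ℚ[X]) ^ (a * m + m - 1 - i))) :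
    ((X : ℚ[X]) ^ m - 1) ∣
      g - ∑ d ∈ m.divisors, C (A d) * ∑ j ∈ range d, X ^ (j * (m / d)) := by
  refine X_pow_sub_one_dvd_of_eval_eq_zero hm fun ω hω => ?_
  have hr : 0 < orderOf ω := orderOf_pos_iff.2 (isOfFinOrder_iff_pow_eq_one.2 ⟨m, hm, hω⟩)
  have hprim := IsPrimitiveRoot.orderOf ω
  obtain ⟨n, hmn⟩ := orderOf_dvd_of_pow_eq_one hω
  generalize orderOf ω = r at hr hprim hmn
  subst hmn
  have hn : 0 < n := Nat.pos_of_mul_pos_left hm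
  rw [prod_one_sub_X_pow_reflect] at hg
  have hg' := congrArg (Polynomial.map (algebraMap ℚ ℂ)) hg
  simp only [Polynomial.map_mul, Polynomial.map_prod, Polynomial.map_sub, Polynomial.map_one,
    Polynomial.map_pow, map_X] at hg'
  rw [range_eq_Ico, prod_Ico_add' (fun k => 1 - (X : ℂ[X]) ^ k), zero_add,
    Nat.sub_add_cancel hm] at hg'
  simp only [Polynomial.map_sub, Polynomial.map_sum, Polynomial.map_mul, map_C, Polynomial.map_pow,
    map_X, eval_sub, eval_finsetSum, eval_mul, eval_C, eval_pow, eval_X]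
  rw [eval_gaussian_of_isPrimitiveRoot hr hprim hg', sub_eq_zero]
  have hinv := congrArg (algebraMap ℚ ℂ) (sum_divisors_mul_eq_of_moebius hA hn)
  simp only [map_sum, map_mul, map_prod, map_add, map_div₀, map_natCast, map_one] at hinv
  rw [← hinv]
  have hsub : n.divisors = (r * n).divisors.filter (· ∣ n) := by
    ext d
    simp only [Nat.mem_divisors, mem_filter]
    exact ⟨fun h => ⟨⟨h.1.mul_left r, hm.ne'⟩, h.1⟩, fun h => ⟨h.2, hn.ne'⟩⟩
  rw [hsub, sum_filter]
  refine sum_congr rfl fun d hd => ?_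
  rw [geom_sum_pow_eq_ite hr hn hprim (Nat.dvd_of_mem_divisors hd)]
  split_ifs <;> ring

/-- The sum of the coefficients of a polynomial at the exponents congruent to `1` modulo `m`. -/
noncomputable def coeffSumOne (m : ℕ) : ℚ[X] →ₗ[ℚ] ℚ :=
  lsum fun i => if i % m = 1 then LinearMap.id else 0

theorem coeffSumOne_monomial (m i : ℕ) (c : ℚ) :
    coeffSumOne m (monomial i c) = if i % m = 1 then c else 0 := by
  rw [coeffSumOne, lsum_apply, sum_monomial_index _ _ (by simp)]
  split_ifs <;> rfl

theorem coeffSumOne_eq_zero_of_dvd {m : ℕ} {f : ℚ[X]} (hf : X ^ m - 1 ∣ f) :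
    coeffSumOne m f = 0 := by
  obtain ⟨p, rfl⟩ := hf
  induction p using Polynomial.induction_on' with
  | add p q hp hq => rw [mul_add, map_add, hp, hq, add_zero]
  | monomial i c =>
    rw [sub_mul, one_mul, map_sub, X_pow_mul_monomial, coeffSumOne_monomial, coeffSumOne_monomial,
      Nat.add_mod_right, sub_self]

theorem exists_coeffSumOne_map_natCast (m : ℕ) (p : ℕ[X]) :
    ∃ N : ℕ, coeffSumOne m (p.map (Nat.castRingHom ℚ)) = N := by
  induction p using Polynomial.induction_on' with
  | add p q hp hq =>
    obtain ⟨M, hM⟩ := hp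
    obtain ⟨N, hN⟩ := hq
    exact ⟨M + N, by rw [Polynomial.map_add, map_add, hM, hN, Nat.cast_add]⟩
  | monomial i c =>
    rw [map_monomial, coeffSumOne_monomial]
    exact ⟨if i % m = 1 then c else 0, by split_ifs <;> simp⟩

theorem coeffSumOne_sum_divisors {m : ℕ} (hm : 2 ≤ m) (A : ℕ → ℚ) :
    coeffSumOne m (∑ d ∈ m.divisors, C (A d) * ∑ j ∈ range d, X ^ (j * (m / d))) = A m := by
  simp_rw [mul_sum, C_mul_X_pow_eq_monomial, map_sum, coeffSumOne_monomial]
  have hiff {d j : ℕ} (hd : d ∣ m) (hj : j < d) :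
      j * (m / d) % m = 1 ↔ d = m ∧ j = 1 := by
    obtain ⟨c, rfl⟩ := hd
    have hd0 : 0 < d := by omega
    have hc0 : 0 < c := Nat.pos_of_mul_pos_left (show 0 < d * c by omega)
    rw [Nat.mul_div_cancel_left _ hd0, Nat.mod_eq_of_lt (Nat.mul_lt_mul_of_pos_right hj hc0),
      mul_eq_one]
    constructor
    · rintro ⟨rfl, rfl⟩
      simp
    · rintro ⟨h, rfl⟩
      exact ⟨rfl, Nat.eq_of_mul_eq_mul_left hd0 (by omega)⟩
  rw [sum_eq_single_of_mem m (Nat.mem_divisors_self m (by omega)),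
    sum_eq_single_of_mem 1 (mem_range.2 (by omega))]
  · rw [if_pos ((hiff dvd_rfl (by omega)).2 ⟨rfl, rfl⟩)]
  · intro j hj hj1
    rw [if_neg fun h => hj1 ((hiff dvd_rfl (mem_range.1 hj)).1 h).2]
  · intro d hd hdm
    refine sum_eq_zero fun j hj => ?_
    rw [if_neg fun h => hdm ((hiff (Nat.dvd_of_mem_divisors hd) (mem_range.1 hj)).1 h).1]

theorem exists_natCast_eq_moebius_sum {a : ℕ} {A : ℕ → ℚ}
    (hA : ∀ d, A d = (∑ e ∈ d.divisors, (ArithmeticFunction.moebius (d / e) : ℚ) *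
        ∏ k ∈ Ico 1 e, (((a * e : ℕ) : ℚ) / k + 1)) / d)
    (d : ℕ) : ∃ N : ℕ, A d = N := by
  obtain rfl | rfl | hd : d = 0 ∨ d = 1 ∨ 2 ≤ d := by omega
  · exact ⟨0, by simp [hA]⟩
  · exact ⟨1, by simp [hA]⟩
  · obtain ⟨N, hN⟩ :=
      exists_coeffSumOne_map_natCast d (gaussianBinomial (a * d + d - 1) (d - 1))
    have h := coeffSumOne_eq_zero_of_dvd (X_pow_sub_one_dvd_gaussian_sub (by omega) hA
      (gaussianBinomial_mul_prod ℚ (a * d + d - 1) (d - 1)))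
    rw [map_sub, hN, coeffSumOne_sum_divisors hd, sub_eq_zero] at h
    exact ⟨N, h.symm⟩

/-- for `λ = (am)` and each divisor `d` of `m`, the quantity
`a_d = (1/d) ∑_{e ∣ d} μ(d/e) ∏_{1 ≤ k < e} (ae/k + 1)` is a nonnegative integer, and the
Gaussian binomial coefficient `[am+m-1 choose m-1]_q` (characterized by
`g · ∏_{i<m-1}(1-q^{i+1}) = ∏_{i<m-1}(1-q^{am+m-1-i})`, and equal to
`s_{(am)}(1,q,…,q^{m-1})`) satisfies
`g ≡ ∑_{d ∣ m} a_d (q^m-1)/(q^{m/d}-1) (mod q^m - 1)`. -/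
theorem stmt11 (m a : ℕ) (hm : 2 ≤ m) (ha : 1 ≤ a)
    (A : ℕ → ℚ)
    (hA : ∀ d, A d = (∑ e ∈ d.divisors, (ArithmeticFunction.moebius (d / e) : ℚ) *
        ∏ k ∈ Finset.Ico 1 e, (((a * e : ℕ) : ℚ) / k + 1)) / d)
    (g : ℚ[X])
    (hg : g * ∏ i ∈ Finset.range (m - 1), (1 - (X : ℚ[X]) ^ (i + 1)) =
        ∏ i ∈ Finset.range (m - 1), (1 - (X : ℚ[X]) ^ (a * m + m - 1 - i))) :
    (∀ d ∈ m.divisors, ∃ N : ℕ, A d = (N : ℚ)) ∧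
    ((X : ℚ[X]) ^ m - 1) ∣
      g - ∑ d ∈ m.divisors, Polynomial.C (A d) * ∑ j ∈ Finset.range d, X ^ (j * (m / d)) := by
  exact ⟨fun d _ => exists_natCast_eq_moebius_sum hA d,
    X_pow_sub_one_dvd_gaussian_sub (by omega) hA hg⟩
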